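/- Let α ∈ (1/2, 1) ∪ (1, ∞), let p ∈ Δ_n satisfy p[j] > 0 for all j, and assume Σ_{j=1}^n p[j] W(j)^α is positive definite. Define the fixed-point map F on positive definite matrices by F(Q) := (Σ_{j=1}^n p[j] W(j)^α / Tr[W(j)^α Q^{1−α}])^{1/α}. Let Q* be a positive definite matrix satisfying F(Q*) = Q*. Then for every positive definite matrix Q, one has d_T(F(Q)^{1−α}, (Q*)^{1−α}) ≤ (|1−α|/α) · d_T(Q^{1−α}, (Q*)^{1−α}). -/

import Mathlib

open Matrix
open scoped ComplexOrder

/-- Matrix power of a Hermitian matrix, defined by applying `t ↦ t ^ r` (real `rpow`)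
to the eigenvalues in a spectral decomposition. Returns `0` on non-Hermitian input. -/
noncomputable def matRpow {d : ℕ} (A : Matrix (Fin d) (Fin d) ℂ) (r : ℝ) :
    Matrix (Fin d) (Fin d) ℂ :=
  if hA : A.IsHermitian then
    (hA.eigenvectorUnitary : Matrix (Fin d) (Fin d) ℂ) *
      Matrix.diagonal (fun i => ((hA.eigenvalues i ^ r : ℝ) : ℂ)) *
      (star hA.eigenvectorUnitary : Matrix (Fin d) (Fin d) ℂ)
  else 0

/-- Loewner order: `A ⪯ B` iff `B - A` is positive semidefinite. -/
def loewnerLE {d : ℕ} (A B : Matrix (Fin d) (Fin d) ℂ) : Prop := (B - A).PosSemidef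

/-- Thompson metric on positive definite matrices. -/
noncomputable def thompsonDist {d : ℕ} (V U : Matrix (Fin d) (Fin d) ℂ) : ℝ :=
  sInf {r : ℝ | 0 ≤ r ∧ loewnerLE (Real.exp (-r) • V) U ∧ loewnerLE U (Real.exp r • V)}

/-- The fixed-point map `F(Q) = (∑ⱼ p[j] W(j)^α / Tr[W(j)^α Q^{1-α}])^{1/α}`. -/
noncomputable def augFixedPointMap {n d : ℕ} (α : ℝ) (W : Fin n → Matrix (Fin d) (Fin d) ℂ)
    (p : Fin n → ℝ) (Q : Matrix (Fin d) (Fin d) ℂ) : Matrix (Fin d) (Fin d) ℂ :=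
  matRpow (∑ j, (p j / ((matRpow (W j) α * matRpow Q (1 - α)).trace).re) • matRpow (W j) α)
    (1 / α)

section Helpers

open scoped MatrixOrder Matrix.Norms.L2Operator

lemma matRpow_eq_cfc {d : ℕ} {A : Matrix (Fin d) (Fin d) ℂ} (hA : 0 ≤ A) (r : ℝ) :
    matRpow A r = A ^ r := by
  have hH : A.IsHermitian := hA.posSemidef.1
  rw [CFC.rpow_eq_cfc_real hA, hH.cfc_eq]
  rw [matRpow, dif_pos hH]
  rfl

lemma smul_rpow_aux {d : ℕ} {A : Matrix (Fin d) (Fin d) ℂ} (hA : 0 ≤ A) (r c : ℝ) (hc : 0 < c) :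
    (c • A) ^ r = c ^ r • A ^ r := by
  have hf : ∀ (g : ℝ → ℝ), ContinuousOn g (spectrum ℝ A) := by
    intro g
    exact Matrix.finite_real_spectrum.continuousOn _
  have hf2 : ∀ (g : ℝ → ℝ), ContinuousOn g ((c • ·) '' spectrum ℝ A) := by
    intro g
    exact (Matrix.finite_real_spectrum.image _).continuousOn _
  rw [CFC.rpow_eq_cfc_real (smul_nonneg hc.le hA), CFC.rpow_eq_cfc_real hA]
  have h1 := cfc_comp_smul c (fun x : ℝ => x ^ r) A (hf2 _) hA.posSemidef.1
  have h2 := cfc_smul (c ^ r) (fun x : ℝ => x ^ r) A (hf _)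
  refine h1.symm.trans (Eq.trans ?_ h2)
  refine cfc_congr fun x hx => ?_
  have : 0 ≤ x := spectrum_nonneg_of_nonneg hA hx
  simp [Real.mul_rpow hc.le this]

lemma rpow_mono_aux {d : ℕ} {A B : Matrix (Fin d) (Fin d) ℂ} (hA : IsStrictlyPositive A)
    (hAB : A ≤ B) (s : ℝ) : (0 ≤ s → s ≤ 1 → A ^ s ≤ B ^ s) ∧ (s < 0 → -1 ≤ s → B ^ s ≤ A ^ s) := by
  have hB : IsStrictlyPositive B := hA.of_le hAB
  refine ⟨fun h0 h1 => CFC.rpow_le_rpow ⟨h0, h1⟩ hAB, fun h0 h1 => ?_⟩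
  have h2 : A ^ (-s) ≤ B ^ (-s) := CFC.rpow_le_rpow ⟨by linarith, by linarith⟩ hAB
  have h3 := CStarAlgebra.ringInverse_le_ringInverse h2 (IsStrictlyPositive.rpow A _ hA)
  rwa [CFC.inverse_rpow A _ (by linarith) hA, CFC.inverse_rpow B _ (by linarith) hB, neg_neg] at h3

lemma exists_smul_le_aux {d : ℕ} (hd : 0 < d) {A B : Matrix (Fin d) (Fin d) ℂ}
    (hA : IsStrictlyPositive A)
    (hB : IsStrictlyPositive B) : ∃ r : ℝ, 0 < r ∧ B ≤ r • A := by
  haveI : Nonempty (Fin d) := ⟨⟨0, hd⟩⟩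
  obtain ⟨e, he, hle⟩ := (CFC.exists_pos_algebraMap_le_iff hA.isSelfAdjoint).2
    fun x hx ↦ hA.spectrum_pos hx
  have h1 := IsSelfAdjoint.le_algebraMap_norm_self hB.isSelfAdjoint
  refine ⟨(‖B‖ + 1) / e, by positivity, ?_⟩
  have h2 : ((‖B‖ + 1) / e) • algebraMap ℝ (Matrix (Fin d) (Fin d) ℂ) e
      ≤ ((‖B‖ + 1) / e) • A := smul_le_smul_of_nonneg_left hle (by positivity)
  refine le_trans (h1.trans ?_) h2
  rw [Algebra.algebraMap_eq_smul_one, Algebra.algebraMap_eq_smul_one, smul_smul,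
    div_mul_cancel₀ _ he.ne']
  exact smul_le_smul_of_nonneg_right (by linarith) zero_le_one

lemma smul_le_flip {d : ℕ} {A B : Matrix (Fin d) (Fin d) ℂ} (r : ℝ)
    (h : B ≤ Real.exp r • A) : Real.exp (-r) • B ≤ A := by
  have h2 := smul_le_smul_of_nonneg_left h (Real.exp_pos (-r)).le
  rwa [smul_smul, ← Real.exp_add, neg_add_cancel, Real.exp_zero, one_smul] at h2

lemma smul_le_flip' {d : ℕ} {A B : Matrix (Fin d) (Fin d) ℂ} (r : ℝ)
    (h : Real.exp (-r) • B ≤ A) : B ≤ Real.exp r • A := by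
  have h2 := smul_le_flip (-r) (A := B) (B := A)
  have h2 := smul_le_smul_of_nonneg_left h (Real.exp_pos r).le
  rwa [smul_smul, ← Real.exp_add, add_neg_cancel, Real.exp_zero, one_smul] at h2

lemma thompson_nonempty {d : ℕ} (hd : 0 < d) {A B : Matrix (Fin d) (Fin d) ℂ}
    (hA : IsStrictlyPositive A)
    (hB : IsStrictlyPositive B) : ∃ r : ℝ, 0 ≤ r ∧ Real.exp (-r) • A ≤ B ∧ B ≤ Real.exp r • A := by
  obtain ⟨a, ha, h1⟩ := exists_smul_le_aux hd hA hB
  obtain ⟨b, hb, h2⟩ := exists_smul_le_aux hd hB hA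
  have key : ∀ c : ℝ, 0 < c → c ≤ Real.exp (max 0 (max (Real.log a) (Real.log b))) ∨
    ¬ (Real.log c ≤ max 0 (max (Real.log a) (Real.log b))) := by
    intro c hc
    by_cases h : Real.log c ≤ max 0 (max (Real.log a) (Real.log b))
    · left
      rw [← Real.exp_log hc]
      exact Real.exp_le_exp.2 h
    · right; exact h
  refine ⟨max 0 (max (Real.log a) (Real.log b)), le_max_left _ _, smul_le_flip _ ?_, ?_⟩
  · refine h2.trans (smul_le_smul_of_nonneg_right ?_ hB.nonneg)
    exact (key b hb).resolve_right (by simp)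
  · refine h1.trans (smul_le_smul_of_nonneg_right ?_ hA.nonneg)
    exact (key a ha).resolve_right (by simp)

lemma trace_nonneg_aux {d : ℕ} {A V : Matrix (Fin d) (Fin d) ℂ} (hA : 0 ≤ A) (h : 0 ≤ V) :
    0 ≤ (A * V).trace.re := by
  obtain ⟨X, rfl⟩ := CStarAlgebra.nonneg_iff_eq_star_mul_self.mp hA
  rw [mul_assoc, Matrix.trace_mul_comm]
  have := (star_right_conjugate_nonneg h X).posSemidef.trace_nonneg
  exact (Complex.le_def.1 this).1

lemma trace_mono_aux {d : ℕ} {A V U : Matrix (Fin d) (Fin d) ℂ} (hA : 0 ≤ A) (h : V ≤ U) :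
    (A * V).trace.re ≤ (A * U).trace.re := by
  have := trace_nonneg_aux hA (sub_nonneg.2 h)
  rw [mul_sub, Matrix.trace_sub, Complex.sub_re] at this
  linarith

lemma pow_bound_aux {d : ℕ} {A B : Matrix (Fin d) (Fin d) ℂ} (hA : IsStrictlyPositive A)
    (hB : IsStrictlyPositive B) (r s : ℝ) (hs : |s| ≤ 1) (h : A ≤ Real.exp r • B)
    (h' : B ≤ Real.exp r • A) :
    B ^ s ≤ Real.exp (|s| * r) • A ^ s := by
  have hs' := abs_le.1 hs
  rcases le_or_gt 0 s with h0 | h0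
  · have := (rpow_mono_aux hB h' s).1 h0 hs'.2
    rw [smul_rpow_aux hA.nonneg _ _ (Real.exp_pos _), ← Real.exp_mul] at this
    rwa [abs_of_nonneg h0, mul_comm]
  · have := (rpow_mono_aux hA h s).2 h0 hs'.1
    rw [smul_rpow_aux hB.nonneg _ _ (Real.exp_pos _), ← Real.exp_mul] at this
    rw [abs_of_neg h0]
    apply smul_le_flip'
    convert this using 3
    ring

/-- The inner sum of the fixed-point map. -/
noncomputable def innerSum {n d : ℕ} (A : Fin n → Matrix (Fin d) (Fin d) ℂ)
    (p : Fin n → ℝ) (V : Matrix (Fin d) (Fin d) ℂ) : Matrix (Fin d) (Fin d) ℂ :=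
  ∑ j, (p j / ((A j * V).trace).re) • A j

lemma innerSum_nonneg {n d : ℕ} {A : Fin n → Matrix (Fin d) (Fin d) ℂ} (hA : ∀ j, 0 ≤ A j)
    {p : Fin n → ℝ} (hp : ∀ j, 0 < p j) {V : Matrix (Fin d) (Fin d) ℂ} (hV : 0 ≤ V) :
    0 ≤ innerSum A p V :=
  Finset.sum_nonneg fun j _ =>
    smul_nonneg (div_nonneg (hp j).le (trace_nonneg_aux (hA j) hV)) (hA j)

lemma innerSum_le {n d : ℕ} {A : Fin n → Matrix (Fin d) (Fin d) ℂ} (hA : ∀ j, 0 ≤ A j)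
    {p : Fin n → ℝ} (hp : ∀ j, 0 < p j) {V U : Matrix (Fin d) (Fin d) ℂ} (hV : 0 ≤ V)
    (hU : 0 ≤ U) (r : ℝ) (h : V ≤ Real.exp r • U) (h' : U ≤ Real.exp r • V) :
    innerSum A p U ≤ Real.exp r • innerSum A p V := by
  unfold innerSum
  rw [Finset.smul_sum]
  refine Finset.sum_le_sum fun j _ => ?_
  rw [smul_smul]
  refine smul_le_smul_of_nonneg_right ?_ (hA j)
  have h1 := trace_mono_aux (hA j) h
  have h2 := trace_mono_aux (hA j) h'
  rw [Matrix.mul_smul, Matrix.trace_smul, Complex.smul_re, smul_eq_mul] at h1 h2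
  have u0 := trace_nonneg_aux (hA j) hU
  have v0 := trace_nonneg_aux (hA j) hV
  have e0 := Real.exp_pos r
  generalize ((A j * U).trace).re = u at *
  generalize ((A j * V).trace).re = v at *
  rcases u0.eq_or_lt with h0 | h0
  · rw [← h0, div_zero]
    have := (hp j).le
    positivity
  · have hv : 0 < v := by
      by_contra hv
      have : v = 0 := by linarith
      rw [this, mul_zero] at h2
      linarith
    rw [mul_div_assoc', div_le_div_iff₀ h0 hv]
    nlinarith [hp j]


lemma aug_aux {n d : ℕ} (hd : 0 < d) (α : ℝ) (hα0 : 0 < α)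
    (hs : |(1 - α) / α| ≤ 1)
    (W : Fin n → Matrix (Fin d) (Fin d) ℂ) (hW : ∀ j, 0 ≤ W j)
    (p : Fin n → ℝ) (hppos : ∀ j, 0 < p j)
    (Qstar : Matrix (Fin d) (Fin d) ℂ) (hQstar : IsStrictlyPositive Qstar)
    (hfix : augFixedPointMap α W p Qstar = Qstar)
    (Q : Matrix (Fin d) (Fin d) ℂ) (hQ : IsStrictlyPositive Q) :
    thompsonDist (matRpow (augFixedPointMap α W p Q) (1 - α)) (matRpow Qstar (1 - α))
      ≤ (|1 - α| / α) * thompsonDist (matRpow Q (1 - α)) (matRpow Qstar (1 - α)) := by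
  set A : Fin n → Matrix (Fin d) (Fin d) ℂ := fun j => W j ^ α with hAdef
  have hA : ∀ j, 0 ≤ A j := fun j => CFC.rpow_nonneg
  have hF : ∀ P : Matrix (Fin d) (Fin d) ℂ, 0 ≤ P →
      augFixedPointMap α W p P = innerSum A p (P ^ (1 - α)) ^ (1 / α) := by
    intro P hP
    rw [← matRpow_eq_cfc (innerSum_nonneg hA hppos CFC.rpow_nonneg)]
    unfold augFixedPointMap innerSum
    simp only [hAdef, matRpow_eq_cfc (hW _), matRpow_eq_cfc hP]
  have hV : IsStrictlyPositive (Q ^ (1 - α)) := IsStrictlyPositive.rpow Q _ hQ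
  have hVs : IsStrictlyPositive (Qstar ^ (1 - α)) := IsStrictlyPositive.rpow Qstar _ hQstar
  have hS0 := innerSum_nonneg hA hppos hV.nonneg
  have hSs0 := innerSum_nonneg hA hppos hVs.nonneg
  have hfix' := hfix
  rw [hF Qstar hQstar.nonneg] at hfix'
  have hSs : IsStrictlyPositive (innerSum A p (Qstar ^ (1 - α))) := by
    refine IsUnit.isStrictlyPositive ?_ hSs0
    rw [← CFC.isUnit_rpow_iff _ (1 / α) (by positivity) hSs0, hfix']
    exact hQstar.isUnit
  obtain ⟨r0, hr0, h1, h2⟩ := thompson_nonempty hd hV hVs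
  have hS : IsStrictlyPositive (innerSum A p (Q ^ (1 - α))) := by
    have := smul_le_flip _
      (innerSum_le hA hppos hV.nonneg hVs.nonneg r0 (smul_le_flip' _ h1) h2)
    refine IsStrictlyPositive.of_le ?_ this
    exact hSs.smul (Real.exp_pos _)
  have e1 : matRpow (augFixedPointMap α W p Q) (1 - α)
      = innerSum A p (Q ^ (1 - α)) ^ ((1 - α) / α) := by
    rw [hF Q hQ.nonneg, matRpow_eq_cfc CFC.rpow_nonneg,
      CFC.rpow_rpow _ _ _ (by positivity) hS]
    congr 1
    ring
  have e2 : matRpow Qstar (1 - α)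
      = innerSum A p (Qstar ^ (1 - α)) ^ ((1 - α) / α) := by
    conv_lhs => rw [← hfix']
    rw [matRpow_eq_cfc CFC.rpow_nonneg, CFC.rpow_rpow _ _ _ (by positivity) hSs]
    congr 1
    ring
  have e3 : |1 - α| / α = |(1 - α) / α| := by rw [abs_div, abs_of_pos hα0]
  rw [e3]
  have main : ∀ r : ℝ, 0 ≤ r → Real.exp (-r) • Q ^ (1 - α) ≤ Qstar ^ (1 - α) →
      Qstar ^ (1 - α) ≤ Real.exp r • Q ^ (1 - α) →
      thompsonDist (matRpow (augFixedPointMap α W p Q) (1 - α)) (matRpow Qstar (1 - α))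
        ≤ |(1 - α) / α| * r := by
    intro r hr g1 g2
    have k1 := innerSum_le hA hppos hV.nonneg hVs.nonneg r (smul_le_flip' _ g1) g2
    have k2 := innerSum_le hA hppos hVs.nonneg hV.nonneg r g2 (smul_le_flip' _ g1)
    refine csInf_le ⟨0, fun x hx => hx.1⟩ ⟨by positivity, ?_, ?_⟩
    · rw [e1, e2]
      exact smul_le_flip _ (pow_bound_aux hSs hS r _ hs k1 k2)
    · rw [e1, e2]
      exact pow_bound_aux hS hSs r _ hs k2 k1
  rcases (abs_nonneg ((1 - α) / α)).eq_or_lt with h0 | h0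
  · have := main r0 hr0 h1 h2
    rw [← h0, zero_mul] at this ⊢
    exact this
  · rw [← div_le_iff₀' h0, matRpow_eq_cfc hQ.nonneg]
    conv_rhs => rw [matRpow_eq_cfc hQstar.nonneg]
    refine le_csInf ⟨r0, hr0, h1, h2⟩ ?_
    rintro r ⟨hr, g1, g2⟩
    rw [div_le_iff₀' h0]
    exact main r hr g1 g2

end Helpers

/-- one-step contraction of the fixed-point map with respect to the
Thompson metric. -/
theorem aug_fixed_point_contraction {n d : ℕ} (hn : 0 < n) (hd : 0 < d) (α : ℝ)
    (hα : α ∈ Set.Ioo (1 / 2 : ℝ) 1 ∪ Set.Ioi (1 : ℝ))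
    (W : Fin n → Matrix (Fin d) (Fin d) ℂ)
    (hW : ∀ j, (W j).PosSemidef ∧ (W j).trace = 1)
    (p : Fin n → ℝ) (hp : p ∈ stdSimplex ℝ (Fin n)) (hppos : ∀ j, 0 < p j)
    (hPD : (∑ j, p j • matRpow (W j) α).PosDef)
    (Qstar : Matrix (Fin d) (Fin d) ℂ) (hQstar : Qstar.PosDef)
    (hfix : augFixedPointMap α W p Qstar = Qstar)
    (Q : Matrix (Fin d) (Fin d) ℂ) (hQ : Q.PosDef) :
    thompsonDist (matRpow (augFixedPointMap α W p Q) (1 - α)) (matRpow Qstar (1 - α))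
      ≤ (|1 - α| / α) * thompsonDist (matRpow Q (1 - α)) (matRpow Qstar (1 - α)) := by

  have hα0 : 0 < α := by
    rcases hα with h | h
    · linarith [h.1]
    · linarith [Set.mem_Ioi.1 h]
  have hs : |(1 - α) / α| ≤ 1 := by
    rw [abs_div, abs_of_pos hα0, div_le_one hα0, abs_le]
    rcases hα with h | h
    · constructor <;> linarith [h.1, h.2]
    · have := Set.mem_Ioi.1 h
      constructor <;> linarith
  open scoped MatrixOrder Matrix.Norms.L2Operator in
  have hQ' : IsStrictlyPositive Q := Matrix.isStrictlyPositive_iff_posDef.2 hQ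
  open scoped MatrixOrder Matrix.Norms.L2Operator in
  exact aug_aux hd α hα0 hs W (fun j => (hW j).1.nonneg) p hppos Qstar
    (Matrix.isStrictlyPositive_iff_posDef.2 hQstar) hfix Q hQ'
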